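/- arXiv:2202.08932 — 3 statements merged into one kernel-verified Lean document; each statement's English description precedes it below -/
import Mathlib

section
/- If f = a²·c + b³ for linear forms a, b, c over ℂ, then Hess(f) = −24·[abc]²·a²·b. -/
open MvPolynomial

/-- Ternary forms: polynomials in three variables over `ℂ`. -/
abbrev Ternary : Type := MvPolynomial (Fin 3) ℂ

/-- A linear form is a homogeneous polynomial of degree 1. -/
def IsLinearForm (a : Ternary) : Prop := MvPolynomial.IsHomogeneous a 1

/-- The Waring rank of a form `f` (with respect to degree `d`): the least `r`
such that `f` is a sum of `r` `d`-th powers of linear forms. -/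
noncomputable def waringRank (d : ℕ) (f : Ternary) : ℕ :=
  sInf {r : ℕ | ∃ l : Fin r → Ternary, (∀ i, IsLinearForm (l i)) ∧ f = ∑ i, (l i) ^ d}

/-- The Hessian determinant of a ternary form: the determinant of the matrix of
second partial derivatives. -/
noncomputable def hess (f : Ternary) : Ternary :=
  Matrix.det (Matrix.of fun i j : Fin 3 =>
    MvPolynomial.pderiv i (MvPolynomial.pderiv j f))

/-- `[abc]`: the determinant of the 3×3 matrix whose rows are the coefficients of
the linear forms `a`, `b`, `c`. -/
noncomputable def bracket (a b c : Ternary) : ℂ :=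
  Matrix.det (Matrix.of
    ![![MvPolynomial.coeff (Finsupp.single 0 1) a, MvPolynomial.coeff (Finsupp.single 1 1) a,
        MvPolynomial.coeff (Finsupp.single 2 1) a],
      ![MvPolynomial.coeff (Finsupp.single 0 1) b, MvPolynomial.coeff (Finsupp.single 1 1) b,
        MvPolynomial.coeff (Finsupp.single 2 1) b],
      ![MvPolynomial.coeff (Finsupp.single 0 1) c, MvPolynomial.coeff (Finsupp.single 1 1) c,
        MvPolynomial.coeff (Finsupp.single 2 1) c]])

/-- The partial derivatives of a linear form are its coefficients. -/
theorem IsLinearForm.pderiv_eq_C {a : Ternary} (ha : IsLinearForm a) (i : Fin 3) :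
    pderiv i a = C (coeff (Finsupp.single i 1) a) := by
  have h : (pderiv i a).IsHomogeneous 0 := IsHomogeneous.pderiv ha
  rw [← totalDegree_zero_iff_isHomogeneous, totalDegree_eq_zero_iff_eq_C] at h
  rw [h, coeff_pderiv]
  simp

/-- The second partial derivatives of `a² c + b³`. -/
theorem pderiv_pderiv_cusp {a b c : Ternary}
    (ha : IsLinearForm a) (hb : IsLinearForm b) (hc : IsLinearForm c) (i j : Fin 3) :
    pderiv i (pderiv j (a ^ 2 * c + b ^ 3)) =
      2 * c * pderiv i a * pderiv j a
        + 2 * a * (pderiv i a * pderiv j c + pderiv j a * pderiv i c)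
        + 6 * b * pderiv i b * pderiv j b := by
  have h2 : pderiv i (2 : Ternary) = 0 := pderiv_C (a := 2)
  have h3 : pderiv i (3 : Ternary) = 0 := pderiv_C (a := 3)
  simp only [map_add, Derivation.leibniz, Derivation.leibniz_pow, smul_eq_mul, nsmul_eq_mul,
    ha.pderiv_eq_C, hb.pderiv_eq_C, hc.pderiv_eq_C, pderiv_C, Nat.cast_ofNat, h2, h3]
  ring

/-- The Hessian of `a² c + b³`. -/
theorem hess_cusp (a b c : Ternary)
    (ha : IsLinearForm a) (hb : IsLinearForm b) (hc : IsLinearForm c) :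
    hess (a ^ 2 * c + b ^ 3) =
      MvPolynomial.C (-24 * bracket a b c ^ 2) * (a ^ 2 * b) := by
  simp only [hess, bracket, Matrix.det_fin_three, Matrix.of_apply,
    pderiv_pderiv_cusp ha hb hc, ha.pderiv_eq_C, hb.pderiv_eq_C, hc.pderiv_eq_C]
  simp only [Matrix.cons_val, map_mul, map_pow, map_sub, map_add, map_neg, map_ofNat]
  ring
end

section
/- If f = a·(a² + b·c) for linearly independent linear forms a, b, c over ℂ, then the Waring rank of the ternary cubic form f equals 4. -/
open MvPolynomial

theorem IsLinearForm.exists_eq_sum {a : Ternary} (ha : IsLinearForm a) :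
    ∃ w : Fin 3 → ℂ, a = ∑ i, C (w i) * X i := by
  have h : a ∈ Submodule.span ℂ (Set.range (X : Fin 3 → Ternary)) := by
    rw [← homogeneousSubmodule_one_eq_span_X]
    exact ha
  obtain ⟨w, hw⟩ := (Submodule.mem_span_range_iff_exists_fun ℂ).1 h
  exact ⟨w, by simp [← hw, smul_eq_C_mul]⟩

theorem IsLinearForm.eval_linear_comb {a : Ternary} (ha : IsLinearForm a)
    (e : Fin 3 → Fin 3 → ℂ) (x y z : ℂ) :
    eval (x • e 0 + y • e 1 + z • e 2) a =
      x * eval (e 0) a + y * eval (e 1) a + z * eval (e 2) a := by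
  obtain ⟨w, rfl⟩ := ha.exists_eq_sum
  simp [Fin.sum_univ_three]
  ring

theorem IsLinearForm.C_mul {a : Ternary} (ha : IsLinearForm a) (t : ℂ) :
    IsLinearForm (C t * a) :=
  IsHomogeneous.C_mul ha t

/-- Linearly independent linear forms admit a dual basis of points. -/
theorem exists_dual_points (m : Fin 3 → Ternary) (hm : ∀ i, IsLinearForm (m i))
    (hind : LinearIndependent ℂ m) :
    ∃ e : Fin 3 → Fin 3 → ℂ, ∀ i j, eval (e j) (m i) = if i = j then 1 else 0 := by
  choose w hw using fun i => (hm i).exists_eq_sum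
  have hdet : (Matrix.of w).det ≠ 0 := by
    intro h0
    obtain ⟨v, hv, hv0⟩ := Matrix.exists_vecMul_eq_zero_iff.2 h0
    refine hv (funext (Fintype.linearIndependent_iff.1 hind v ?_))
    have hv1 : ∀ j, ∑ i, v i * w i j = 0 := fun j => congrFun hv0 j
    calc ∑ i, v i • m i = ∑ i, ∑ j, C (v i * w i j) * X j := by
          refine Finset.sum_congr rfl fun i _ => ?_
          rw [hw i, smul_eq_C_mul, Finset.mul_sum]
          exact Finset.sum_congr rfl fun j _ => by rw [map_mul, mul_assoc]
      _ = ∑ j, C (∑ i, v i * w i j) * X j := by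
          rw [Finset.sum_comm]
          simp only [map_sum, Finset.sum_mul]
      _ = 0 := by simp [hv1]
  have hinv := Matrix.mul_nonsing_inv (Matrix.of w) hdet.isUnit
  refine ⟨fun j k => (Matrix.of w)⁻¹ k j, fun i j => ?_⟩
  have := congrFun (congrFun hinv i) j
  rw [Matrix.mul_apply, Matrix.one_apply] at this
  rw [← this, hw i]
  simp

/-- The function `x³ + xyz` is not a sum of three cubes of linear functions. -/
theorem not_sum_three_cubes (p q r : Fin 3 → ℂ)
    (h : ∀ x y z : ℂ, x * (x ^ 2 + y * z) = ∑ i, (x * p i + y * q i + z * r i) ^ 3) : False := by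
  simp only [Fin.sum_univ_three] at h
  have qqq : q 0 ^ 2 * q 0 + q 1 ^ 2 * q 1 + q 2 ^ 2 * q 2 = 0 := by
    linear_combination -h 0 1 0
  have rrr : r 0 ^ 3 + r 1 ^ 3 + r 2 ^ 3 = 0 := by
    linear_combination -h 0 0 1
  have ppp : p 0 ^ 3 + p 1 ^ 3 + p 2 ^ 3 = 1 := by
    linear_combination -h 1 0 0
  have pqq : q 0 ^ 2 * p 0 + q 1 ^ 2 * p 1 + q 2 ^ 2 * p 2 = 0 := by
    linear_combination (-h 1 1 0 - h 1 (-1) 0 + 2 * h 1 0 0) / 6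
  have prr : p 0 * r 0 ^ 2 + p 1 * r 1 ^ 2 + p 2 * r 2 ^ 2 = 0 := by
    linear_combination (-h 1 0 1 - h 1 0 (-1) + 2 * h 1 0 0) / 6
  have rqq : q 0 ^ 2 * r 0 + q 1 ^ 2 * r 1 + q 2 ^ 2 * r 2 = 0 := by
    linear_combination (-h 0 1 1 - h 0 (-1) 1 + 2 * h 0 0 1) / 6
  have qrr : q 0 * r 0 ^ 2 + q 1 * r 1 ^ 2 + q 2 * r 2 ^ 2 = 0 := by
    linear_combination (-h 0 1 1 - h 0 1 (-1) + 2 * h 0 1 0) / 6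
  have ppq : p 0 ^ 2 * q 0 + p 1 ^ 2 * q 1 + p 2 ^ 2 * q 2 = 0 := by
    linear_combination (-h 1 1 0 - h (-1) 1 0 + 2 * h 0 1 0) / 6
  have ppr : p 0 ^ 2 * r 0 + p 1 ^ 2 * r 1 + p 2 ^ 2 * r 2 = 0 := by
    linear_combination (-h 1 0 1 - h (-1) 0 1 + 2 * h 0 0 1) / 6
  have pqr : p 0 * q 0 * r 0 + p 1 * q 1 * r 1 + p 2 * q 2 * r 2 = 1 / 6 := by
    linear_combination (-h 1 1 1 - ppp - qqq - rrr - 3 * (ppq + ppr + pqq + prr + rqq + qrr)) / 6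
  by_cases hdet : (Matrix.of ![p, q, r]).det = 0
  · obtain ⟨v, hv, hv0⟩ := Matrix.exists_vecMul_eq_zero_iff.2 hdet
    have hv1 : ∀ i, v 0 * p i + v 1 * q i + v 2 * r i = 0 := fun i => by
      simpa [Matrix.vecMul, dotProduct, Fin.sum_univ_three] using congrFun hv0 i
    refine hv (funext fun i => ?_)
    fin_cases i
    · change v 0 = 0
      linear_combination 6 * (q 0 * r 0 * hv1 0 + q 1 * r 1 * hv1 1 + q 2 * r 2 * hv1 2
        - v 0 * pqr - v 1 * rqq - v 2 * qrr)
    · change v 1 = 0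
      linear_combination 6 * (p 0 * r 0 * hv1 0 + p 1 * r 1 * hv1 1 + p 2 * r 2 * hv1 2
        - v 0 * ppr - v 1 * pqr - v 2 * prr)
    · change v 2 = 0
      linear_combination 6 * (p 0 * q 0 * hv1 0 + p 1 * q 1 * hv1 1 + p 2 * q 2 * hv1 2
        - v 0 * ppq - v 1 * pqq - v 2 * pqr)
  · have hq : (fun i => q i ^ 2) = 0 := by
      refine Matrix.eq_zero_of_mulVec_eq_zero hdet (funext fun i => ?_)
      fin_cases i <;> simp [Matrix.mulVec, dotProduct, Fin.sum_univ_three]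
      · linear_combination pqq
      · linear_combination qqq
      · linear_combination rqq
    have hq' : ∀ i, q i = 0 := fun i => by simpa using congrFun hq i
    simp [hq'] at pqr

/-- `a (a² + b c)` is a sum of four cubes. -/
theorem exists_four_cubes {a b c : Ternary}
    (ha : IsLinearForm a) (hb : IsLinearForm b) (hc : IsLinearForm c) :
    ∃ l : Fin 4 → Ternary, (∀ i, IsLinearForm (l i)) ∧
      a * (a ^ 2 + b * c) = ∑ i, (l i) ^ 3 := by
  obtain ⟨s, hs⟩ := IsAlgClosed.exists_pow_nat_eq (1 / 96 : ℂ) (n := 3) (by norm_num)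
  obtain ⟨t, ht⟩ := IsAlgClosed.exists_pow_nat_eq (-2 / 96 : ℂ) (n := 3) (by norm_num)
  refine ⟨![C s * (C 4 * a + b + c), C s * (C 4 * a - b - c),
    C t * (C 2 * a + b - c), C t * (C 2 * a - b + c)], ?_, ?_⟩
  · have h4 : IsLinearForm (C 4 * a) := ha.C_mul 4
    have h2 : IsLinearForm (C 2 * a) := ha.C_mul 2
    intro i
    fin_cases i
    · exact IsLinearForm.C_mul ((h4.add hb).add hc) s
    · exact IsLinearForm.C_mul ((h4.sub hb).sub hc) s
    · exact IsLinearForm.C_mul ((h2.add hb).sub hc) t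
    · exact IsLinearForm.C_mul ((h2.sub hb).add hc) t
  · have hs' : (C s : Ternary) ^ 3 = C (1 / 96) := by rw [← map_pow, hs]
    have ht' : (C t : Ternary) ^ 3 = -2 * C (1 / 96) := by
      rw [← map_pow, ht, show (-2 / 96 : ℂ) = -2 * (1 / 96) by norm_num, map_mul, map_neg, map_ofNat]
    have h96 : (96 : Ternary) * C (1 / 96) = 1 := by
      rw [show (96 : Ternary) = C 96 from (map_ofNat C 96).symm, ← map_mul]
      norm_num
    simp only [Fin.sum_univ_four, Matrix.cons_val, mul_pow, hs', ht', map_ofNat]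
    linear_combination -(a * (a ^ 2 + b * c)) * h96

/-- Conic with secant line: `a (a² + b c)` has Waring rank 4. -/
theorem rank_conic_secant (a b c : Ternary)
    (ha : IsLinearForm a) (hb : IsLinearForm b) (hc : IsLinearForm c)
    (hind : LinearIndependent ℂ ![a, b, c]) :
    waringRank 3 (a * (a ^ 2 + b * c)) = 4 := by
  refine le_antisymm (Nat.sInf_le (exists_four_cubes ha hb hc))
    (le_csInf ⟨4, exists_four_cubes ha hb hc⟩ ?_)
  rintro r ⟨l, hl, hf⟩
  by_contra! hr
  obtain ⟨L, hL, hfL⟩ : ∃ L : Fin 3 → Ternary, (∀ i, IsLinearForm (L i)) ∧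
      a * (a ^ 2 + b * c) = ∑ i, (L i) ^ 3 := by
    refine ⟨fun i => if h : (i : ℕ) < r then l ⟨i, h⟩ else 0, fun i => ?_, ?_⟩
    · dsimp only
      split_ifs with h
      · exact hl _
      · exact isHomogeneous_zero _ _ 1
    · rw [hf]
      interval_cases r <;> simp [Fin.sum_univ_succ]
  obtain ⟨e, he⟩ := exists_dual_points ![a, b, c]
    (fun i => by fin_cases i <;> assumption) hind
  refine not_sum_three_cubes (fun i => eval (e 0) (L i)) (fun i => eval (e 1) (L i))
    (fun i => eval (e 2) (L i)) fun x y z => ?_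
  have key := congrArg (eval (x • e 0 + y • e 1 + z • e 2)) hfL
  have hea : ∀ j, eval (e j) a = if 0 = j then 1 else 0 := he 0
  have heb : ∀ j, eval (e j) b = if 1 = j then 1 else 0 := he 1
  have hec : ∀ j, eval (e j) c = if 2 = j then 1 else 0 := he 2
  simp only [map_mul, map_add, map_pow, map_sum, ha.eval_linear_comb, hb.eval_linear_comb,
    hc.eval_linear_comb, (hL _).eval_linear_comb, hea, heb, hec] at key
  simpa using key
end

section
/- Let a, b, c be linearly independent linear forms over ℂ and let s, t ∈ ℂ be not both zero, and set f = s·(a³ + b³ + c³) + t·a·b·c (the Hesse normal form). Then the Waring rank of f equals 3 if t·(t³ − 216·s³) = 0, and equals 4 otherwise. -/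
open MvPolynomial

/-- `f` is a sum of `r` cubes of linear forms. -/
def IsSumOfCubes (r : ℕ) (f : Ternary) : Prop :=
  ∃ l : Fin r → Ternary, (∀ i, IsLinearForm (l i)) ∧ f = ∑ i, (l i) ^ 3

theorem IsSumOfCubes.succ {r : ℕ} {f : Ternary} (h : IsSumOfCubes r f) :
    IsSumOfCubes (r + 1) f := by
  obtain ⟨l, hl, rfl⟩ := h
  refine ⟨Fin.cons 0 l, fun i => ?_, by simp [Fin.sum_univ_succ]⟩
  refine Fin.cases ?_ (fun j => ?_) i
  · exact isHomogeneous_zero _ _ _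
  · exact hl j

theorem IsSumOfCubes.mono {m n : ℕ} (hmn : m ≤ n) {f : Ternary} (h : IsSumOfCubes m f) :
    IsSumOfCubes n f := by
  induction hmn with
  | refl => exact h
  | step _ ih => exact ih.succ

theorem waringRank_three_eq_succ {r : ℕ} {f : Ternary} (h : IsSumOfCubes (r + 1) f)
    (h' : ¬ IsSumOfCubes r f) : waringRank 3 f = r + 1 := by
  refine le_antisymm (Nat.sInf_le h) (le_csInf ⟨_, h⟩ fun n hn => ?_)
  by_contra hlt
  exact h' (IsSumOfCubes.mono (by omega) hn)

theorem isSumOfCubes_sum_C_mul {r : ℕ} (k : Fin r → ℂ) (l : Fin r → Ternary)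
    (hl : ∀ i, IsLinearForm (l i)) : IsSumOfCubes r (∑ i, C (k i) * l i ^ 3) := by
  choose z hz using fun i => IsAlgClosed.exists_pow_nat_eq (k i) (n := 3) (by norm_num)
  refine ⟨fun i => C (z i) * l i, fun i => (hl i).C_mul _, ?_⟩
  refine Finset.sum_congr rfl fun i _ => ?_
  rw [mul_pow, ← C_pow, hz]

theorem exists_sq_add_self_add_one_eq_zero : ∃ w : ℂ, w ^ 2 + w + 1 = 0 := by
  obtain ⟨d, hd⟩ := IsAlgClosed.exists_pow_nat_eq (-3 : ℂ) (n := 2) (by norm_num)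
  exact ⟨(-1 + d) / 2, by linear_combination hd / 4⟩

theorem isSumOfCubes_three_equianharmonic {a b c : Ternary} (ha : IsLinearForm a)
    (hb : IsLinearForm b) (hc : IsLinearForm c) (s : ℂ) :
    IsSumOfCubes 3 (C s * (a ^ 3 + b ^ 3 + c ^ 3) + C (6 * s) * (a * b * c)) := by
  obtain ⟨w, hw⟩ := exists_sq_add_self_add_one_eq_zero
  have h := isSumOfCubes_sum_C_mul (fun _ => s / 3)
    ![a + b + c, a + C w * b + C (w ^ 2) * c, a + C (w ^ 2) * b + C w * c] (by
      intro i
      fin_cases i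
      · exact (ha.add hb).add hc
      · exact (ha.add (hb.C_mul _)).add (hc.C_mul _)
      · exact (ha.add (hb.C_mul _)).add (hc.C_mul _))
  convert h using 1
  have hw' : (C w ^ 2 + C w + 1 : Ternary) = 0 := by
    simpa using congrArg (C (σ := Fin 3)) hw
  have hs : (C s : Ternary) = 3 * C (s / 3) := by
    rw [← map_ofNat (C (σ := Fin 3) (R := ℂ)) 3, ← C_mul]
    congr 1
    ring
  have h6 : (C (6 * s) : Ternary) = 18 * C (s / 3) := by
    rw [← map_ofNat (C (σ := Fin 3) (R := ℂ)) 18, ← C_mul]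
    congr 1
    ring
  simp only [Fin.sum_univ_three, Matrix.cons_val, h6, C_pow]
  rw [hs]
  linear_combination -C (s / 3) * ((C w - 1) * (C w ^ 3 + 2) * (b ^ 3 + c ^ 3)
    + 3 * a ^ 2 * (b + c) + 3 * (C w ^ 2 - C w + 1) * a * (b ^ 2 + c ^ 2)
    + 3 * (C w ^ 3 - C w + 1) * b * c * (b + c) + 12 * (C w - 1) * a * b * c) * hw'

theorem isSumOfCubes_four_of_ne {a b c : Ternary} (ha : IsLinearForm a)
    (hb : IsLinearForm b) (hc : IsLinearForm c) {s t : ℂ} (ht : t ≠ 0) (h3 : t + 3 * s ≠ 0) :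
    IsSumOfCubes 4 (C s * (a ^ 3 + b ^ 3 + c ^ 3) + C t * (a * b * c)) := by
  obtain ⟨x, hx⟩ : ∃ x : ℂ, x = -6 * s / t - 1 := ⟨_, rfl⟩
  have hx1 : x - 1 ≠ 0 := by
    rw [hx]
    intro h
    field_simp at h
    exact h3 (by linear_combination -h / 2)
  obtain ⟨k, hk⟩ : ∃ k : ℂ, k = -t / (6 * (x - 1) ^ 2) := ⟨_, rfl⟩
  have ht' : t = -6 * k * (x - 1) ^ 2 := by
    rw [hk]
    field_simp
  have hs' : s = k * (x - 1) ^ 2 * (x + 1) := by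
    have : t * (x + 1) = -6 * s := by
      rw [hx]
      field_simp
      ring
    rw [ht'] at this
    linear_combination this / 6
  have h := isSumOfCubes_sum_C_mul ![-k * (x ^ 2 + x + 1), k, k, k]
    ![a + b + c, C x * a + b + c, a + C x * b + c, a + b + C x * c] (by
      intro i
      fin_cases i
      · exact (ha.add hb).add hc
      · exact ((ha.C_mul _).add hb).add hc
      · exact (ha.add (hb.C_mul _)).add hc
      · exact (ha.add hb).add (hc.C_mul _))
  convert h using 1
  rw [hs', ht']
  simp only [Fin.sum_univ_four, Matrix.cons_val, C_mul, C_add, C_sub, C_neg, C_pow, C_1,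
    map_ofNat]
  ring

theorem isSumOfCubes_three_of_eq_zero {a b c : Ternary} (ha : IsLinearForm a)
    (hb : IsLinearForm b) (hc : IsLinearForm c) {s t : ℂ}
    (h : t * (t ^ 3 - 216 * s ^ 3) = 0) :
    IsSumOfCubes 3 (C s * (a ^ 3 + b ^ 3 + c ^ 3) + C t * (a * b * c)) := by
  by_cases ht : t = 0
  · have h := isSumOfCubes_sum_C_mul (fun _ => s) ![a, b, c] (by
      intro i
      fin_cases i
      exacts [ha, hb, hc])
    convert h using 1
    simp [ht, Fin.sum_univ_three, mul_add]
  · have h3 : t ^ 3 = 216 * s ^ 3 := by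
      linear_combination (mul_eq_zero.mp h).resolve_left ht
    have hs : s ≠ 0 := by
      rintro rfl
      exact ht (by simpa using h3)
    have hm : (t / (6 * s)) ^ 3 = 1 := by
      field_simp
      linear_combination h3
    convert isSumOfCubes_three_equianharmonic (ha.C_mul (t / (6 * s))) hb hc s using 1
    have e : (C t : Ternary) = C (6 * s) * C (t / (6 * s)) := by
      rw [← C_mul]
      congr 1
      field_simp
    rw [mul_pow, ← C_pow, hm, C_1, e]
    ring

theorem isSumOfCubes_four {a b c : Ternary} (ha : IsLinearForm a)
    (hb : IsLinearForm b) (hc : IsLinearForm c) (s t : ℂ) :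
    IsSumOfCubes 4 (C s * (a ^ 3 + b ^ 3 + c ^ 3) + C t * (a * b * c)) := by
  by_cases ht : t = 0
  · exact (isSumOfCubes_three_of_eq_zero ha hb hc (by simp [ht])).succ
  by_cases h3 : t + 3 * s = 0
  · obtain ⟨w, hw⟩ := exists_sq_add_self_add_one_eq_zero
    have hw3 : w ^ 3 = 1 := by linear_combination (w - 1) * hw
    have hw0 : w ≠ 0 := by
      rintro rfl
      simp at hw
    have hw1 : w ^ 2 ≠ 1 := by
      intro h
      have h2 : w = -2 := by linear_combination hw - h
      rw [h2] at hw
      norm_num at hw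
    have key : w ^ 2 * t + 3 * s ≠ 0 := by
      intro h
      have : (w ^ 2 - 1) * t = 0 := by linear_combination h - h3
      rcases mul_eq_zero.mp this with h | h
      · exact hw1 (by linear_combination h)
      · exact ht h
    convert isSumOfCubes_four_of_ne (ha.C_mul w) hb hc
      (mul_ne_zero (pow_ne_zero 2 hw0) ht) key using 1
    have e : (C w : Ternary) ^ 3 = 1 := by rw [← C_pow, hw3, C_1]
    rw [C_mul, C_pow]
    linear_combination (-(C s * a ^ 3) - C t * (a * b * c)) * e
  · exact isSumOfCubes_four_of_ne ha hb hc ht h3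

theorem IsLinearForm.exists_eval_eq_dotProduct {l : Ternary} (hl : IsLinearForm l) :
    ∃ v : Fin 3 → ℂ, l = ∑ i, C (v i) * X i ∧ ∀ x, eval x l = v ⬝ᵥ x := by
  have h : l ∈ homogeneousSubmodule (Fin 3) ℂ 1 := hl
  rw [homogeneousSubmodule_one_eq_span_X, Submodule.mem_span_range_iff_exists_fun] at h
  obtain ⟨v, rfl⟩ := h
  refine ⟨v, by simp [smul_eq_C_mul], fun x => by simp [dotProduct, smul_eq_C_mul]⟩

/-- Linearly independent linear forms are coordinates: they take arbitrary prescribed values,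
and do so linearly. -/
theorem exists_dual_points_s18 {a b c : Ternary} (ha : IsLinearForm a)
    (hb : IsLinearForm b) (hc : IsLinearForm c) (hind : LinearIndependent ℂ ![a, b, c]) :
    ∃ N : Matrix (Fin 3) (Fin 3) ℂ, ∀ y : Fin 3 → ℂ,
      eval (N.mulVec y) a = y 0 ∧ eval (N.mulVec y) b = y 1 ∧ eval (N.mulVec y) c = y 2 := by
  obtain ⟨u, hu, hu'⟩ := ha.exists_eval_eq_dotProduct
  obtain ⟨v, hv, hv'⟩ := hb.exists_eval_eq_dotProduct
  obtain ⟨w, hw, hw'⟩ := hc.exists_eval_eq_dotProduct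
  obtain ⟨M, hM⟩ : ∃ M : Matrix (Fin 3) (Fin 3) ℂ, M = Matrix.of ![u, v, w] := ⟨_, rfl⟩
  have hunit : IsUnit M := by
    rw [← Matrix.linearIndependent_rows_iff_isUnit]
    have hcomp : (Fintype.linearCombination ℂ (X : Fin 3 → Ternary)) ∘ M.row = ![a, b, c] := by
      funext i
      change Fintype.linearCombination ℂ (X : Fin 3 → Ternary) (M i) = _
      rw [Fintype.linearCombination_apply, hM]
      fin_cases i <;> simp [hu, hv, hw, smul_eq_C_mul]
    refine LinearIndependent.of_comp (Fintype.linearCombination ℂ (X : Fin 3 → Ternary)) ?_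
    rw [hcomp]
    exact hind
  have hMN : M * M⁻¹ = 1 := Matrix.mul_nonsing_inv _ ((Matrix.isUnit_iff_isUnit_det _).mp hunit)
  refine ⟨M⁻¹, fun y => ?_⟩
  have h : M.mulVec (M⁻¹.mulVec y) = y := by rw [Matrix.mulVec_mulVec, hMN, Matrix.one_mulVec]
  rw [hu', hv', hw']
  have h0 := congrFun h 0
  have h1 := congrFun h 1
  have h2 := congrFun h 2
  simp only [Matrix.mulVec, hM] at h0 h1 h2 ⊢
  exact ⟨h0, h1, h2⟩

theorem exists_cubes_of_isSumOfCubes {a b c : Ternary} (ha : IsLinearForm a)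
    (hb : IsLinearForm b) (hc : IsLinearForm c) (hind : LinearIndependent ℂ ![a, b, c])
    {s t : ℂ} {n : ℕ}
    (h : IsSumOfCubes n (C s * (a ^ 3 + b ^ 3 + c ^ 3) + C t * (a * b * c))) :
    ∃ p q r : Fin n → ℂ, ∀ x y z : ℂ,
      ∑ i, (p i * x + q i * y + r i * z) ^ 3 = s * (x ^ 3 + y ^ 3 + z ^ 3) + t * (x * y * z) := by
  obtain ⟨N, hN⟩ := exists_dual_points_s18 ha hb hc hind
  obtain ⟨l, hl, hf⟩ := h
  choose v _ hv using fun i => (hl i).exists_eval_eq_dotProduct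
  refine ⟨fun i => Matrix.vecMul (v i) N 0, fun i => Matrix.vecMul (v i) N 1, fun i => Matrix.vecMul (v i) N 2,
    fun x y z => ?_⟩
  have h := congrArg (eval (N.mulVec ![x, y, z])) hf
  obtain ⟨h0, h1, h2⟩ := hN ![x, y, z]
  simp only [map_add, map_mul, map_pow, map_sum, eval_C, h0, h1, h2, hv,
    Matrix.dotProduct_mulVec] at h
  simp only [dotProduct, Fin.sum_univ_three, Matrix.cons_val] at h
  exact h.symm

/-- Comparison of coefficients in an expression of a Hesse form as a sum of cubes. -/
theorem hesse_moments {n : ℕ} {p q r : Fin n → ℂ} {s t : ℂ}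
    (h : ∀ x y z : ℂ, ∑ i, (p i * x + q i * y + r i * z) ^ 3
      = s * (x ^ 3 + y ^ 3 + z ^ 3) + t * (x * y * z)) :
    ∑ i, p i ^ 3 = s ∧ ∑ i, q i ^ 3 = s ∧ ∑ i, r i ^ 3 = s ∧
    ∑ i, p i ^ 2 * q i = 0 ∧ ∑ i, p i ^ 2 * r i = 0 ∧ ∑ i, p i * q i ^ 2 = 0 ∧
    ∑ i, q i ^ 2 * r i = 0 ∧ ∑ i, p i * r i ^ 2 = 0 ∧ ∑ i, q i * r i ^ 2 = 0 ∧
    6 * ∑ i, p i * q i * r i = t := by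
  have key : ∀ x y z : ℂ, ∑ i, (p i * x + q i * y + r i * z) ^ 3 =
      x ^ 3 * ∑ i, p i ^ 3 + y ^ 3 * ∑ i, q i ^ 3 + z ^ 3 * ∑ i, r i ^ 3 +
      3 * x ^ 2 * y * ∑ i, p i ^ 2 * q i + 3 * x ^ 2 * z * ∑ i, p i ^ 2 * r i +
      3 * x * y ^ 2 * ∑ i, p i * q i ^ 2 + 3 * y ^ 2 * z * ∑ i, q i ^ 2 * r i +
      3 * x * z ^ 2 * ∑ i, p i * r i ^ 2 + 3 * y * z ^ 2 * ∑ i, q i * r i ^ 2 +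
      6 * x * y * z * ∑ i, p i * q i * r i := by
    intro x y z
    simp only [Finset.mul_sum, ← Finset.sum_add_distrib]
    exact Finset.sum_congr rfl fun i _ => by ring
  simp only [key] at h
  have e1 := h 1 0 0
  have e2 := h 0 1 0
  have e3 := h 0 0 1
  have e4 := h 1 1 0
  have e5 := h 1 (-1) 0
  have e6 := h 1 0 1
  have e7 := h 1 0 (-1)
  have e8 := h 0 1 1
  have e9 := h 0 1 (-1)
  have e10 := h 1 1 1
  refine ⟨?_, ?_, ?_, ?_, ?_, ?_, ?_, ?_, ?_, ?_⟩
  · linear_combination e1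
  · linear_combination e2
  · linear_combination e3
  · linear_combination (e4 - e5 - 2 * e2) / 6
  · linear_combination (e6 - e7 - 2 * e3) / 6
  · linear_combination (e4 + e5 - 2 * e1) / 6
  · linear_combination (e8 - e9 - 2 * e3) / 6
  · linear_combination (e6 + e7 - 2 * e1) / 6
  · linear_combination (e8 + e9 - 2 * e2) / 6
  · linear_combination e10 - e4 - e6 - e8 + e1 + e2 + e3

/-- The Aronhold invariant of a ternary cubic with coefficients (up to multinomial factors)
`a, b, c` at the cubes, `a₂, a₃, b₁, b₃, c₁, c₂` at `x²y, x²z, xy², y²z, xz², yz²`, and `m` at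
`xyz`. -/
def aronhold (a b c a₂ a₃ b₁ b₃ c₁ c₂ m : ℂ) : ℂ :=
  a * b * c * m - (b * c * a₂ * a₃ + c * a * b₁ * b₃ + a * b * c₁ * c₂)
    - m * (a * b₃ * c₂ + b * c₁ * a₃ + c * a₂ * b₁)
    + (a * b₁ * c₂ ^ 2 + a * c₁ * b₃ ^ 2 + b * a₂ * c₁ ^ 2 + b * c₂ * a₃ ^ 2
      + c * b₃ * a₂ ^ 2 + c * a₃ * b₁ ^ 2)
    - m ^ 4 + 2 * m ^ 2 * (b₁ * c₁ + c₂ * a₂ + a₃ * b₃)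
    - 3 * m * (a₂ * b₃ * c₁ + a₃ * b₁ * c₂)
    - (b₁ ^ 2 * c₁ ^ 2 + c₂ ^ 2 * a₂ ^ 2 + a₃ ^ 2 * b₃ ^ 2)
    + (c₂ * a₂ * a₃ * b₃ + a₃ * b₃ * b₁ * c₁ + b₁ * c₁ * c₂ * a₂)

theorem aronhold_sum_three_cubes (p q r : Fin 3 → ℂ) :
    aronhold (∑ i, p i ^ 3) (∑ i, q i ^ 3) (∑ i, r i ^ 3) (∑ i, p i ^ 2 * q i)
      (∑ i, p i ^ 2 * r i) (∑ i, p i * q i ^ 2) (∑ i, q i ^ 2 * r i) (∑ i, p i * r i ^ 2)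
      (∑ i, q i * r i ^ 2) (∑ i, p i * q i * r i) = 0 := by
  simp only [aronhold, Fin.sum_univ_three]
  ring

theorem hesse_eq_zero_of_isSumOfCubes_three {a b c : Ternary} (ha : IsLinearForm a)
    (hb : IsLinearForm b) (hc : IsLinearForm c) (hind : LinearIndependent ℂ ![a, b, c])
    {s t : ℂ} (h : IsSumOfCubes 3 (C s * (a ^ 3 + b ^ 3 + c ^ 3) + C t * (a * b * c))) :
    t * (t ^ 3 - 216 * s ^ 3) = 0 := by
  obtain ⟨p, q, r, H⟩ := exists_cubes_of_isSumOfCubes ha hb hc hind h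
  obtain ⟨h1, h2, h3, h4, h5, h6, h7, h8, h9, h10⟩ := hesse_moments H
  have hA := aronhold_sum_three_cubes p q r
  rw [h1, h2, h3, h4, h5, h6, h7, h8, h9] at hA
  rw [← h10]
  simp only [aronhold] at hA
  linear_combination -1296 * hA

theorem hesse_eq_zero_of_isSumOfCubes_two {a b c : Ternary} (ha : IsLinearForm a)
    (hb : IsLinearForm b) (hc : IsLinearForm c) (hind : LinearIndependent ℂ ![a, b, c])
    {s t : ℂ} (h : IsSumOfCubes 2 (C s * (a ^ 3 + b ^ 3 + c ^ 3) + C t * (a * b * c))) :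
    s = 0 ∧ t = 0 := by
  obtain ⟨p, q, r, H⟩ := exists_cubes_of_isSumOfCubes ha hb hc hind h
  obtain ⟨h1, h2, h3, h4, h5, h6, h7, h8, h9, h10⟩ := hesse_moments H
  have hs : Matrix.det !![∑ i, p i ^ 3, ∑ i, p i * q i ^ 2, ∑ i, p i * r i ^ 2;
      ∑ i, p i ^ 2 * q i, ∑ i, q i ^ 3, ∑ i, q i * r i ^ 2;
      ∑ i, p i ^ 2 * r i, ∑ i, q i ^ 2 * r i, ∑ i, r i ^ 3] = 0 := by
    simp only [Matrix.det_fin_three, Fin.sum_univ_two, Matrix.of_apply, Matrix.cons_val]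
    ring
  have ht : Matrix.det !![∑ i, p i * q i * r i, ∑ i, p i ^ 2 * r i, ∑ i, p i ^ 2 * q i;
      ∑ i, q i ^ 2 * r i, ∑ i, p i * q i * r i, ∑ i, p i * q i ^ 2;
      ∑ i, q i * r i ^ 2, ∑ i, p i * r i ^ 2, ∑ i, p i * q i * r i] = 0 := by
    simp only [Matrix.det_fin_three, Fin.sum_univ_two, Matrix.of_apply, Matrix.cons_val]
    ring
  rw [h1, h2, h3, h4, h5, h6, h7, h8, h9] at hs
  rw [h4, h5, h6, h7, h8, h9] at ht
  rw [← h10]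
  simpa [Matrix.det_fin_three] using And.intro hs ht

/-- Waring rank of the Hesse normal form `s (a³ + b³ + c³) + t a b c`. -/
theorem rank_hesse_normal_form (a b c : Ternary)
    (ha : IsLinearForm a) (hb : IsLinearForm b) (hc : IsLinearForm c)
    (hind : LinearIndependent ℂ ![a, b, c]) (s t : ℂ) (hst : ¬ (s = 0 ∧ t = 0)) :
    (t * (t ^ 3 - 216 * s ^ 3) = 0 →
      waringRank 3 (MvPolynomial.C s * (a ^ 3 + b ^ 3 + c ^ 3)
        + MvPolynomial.C t * (a * b * c)) = 3) ∧
    (t * (t ^ 3 - 216 * s ^ 3) ≠ 0 →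
      waringRank 3 (MvPolynomial.C s * (a ^ 3 + b ^ 3 + c ^ 3)
        + MvPolynomial.C t * (a * b * c)) = 4) :=
  ⟨fun h => waringRank_three_eq_succ (isSumOfCubes_three_of_eq_zero ha hb hc h)
      fun h2 => hst (hesse_eq_zero_of_isSumOfCubes_two ha hb hc hind h2),
    fun h => waringRank_three_eq_succ (isSumOfCubes_four ha hb hc s t)
      fun h3 => h (hesse_eq_zero_of_isSumOfCubes_three ha hb hc hind h3)⟩
end
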